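/- For every natural number p ≥ 3 there exists a constant C > 0, depending only on p, such that for every function v : ℝ² → ℝ that is twice continuously differentiable on a neighborhood of the closed unit square [0,1]² and satisfies ∫_{(0,1)²} v dx dy = 0 and ∫_{(0,1)²} ∇v dx dy = (0,0), the following holds with K = (0,1)². Let v̂ be the unique bivariate polynomial of total degree ≤ p − 4 satisfying ∫_K (v − v̂) m dx dy = 0 for every bivariate polynomial m of total degree ≤ p − 4 (with v̂ = 0 when p = 3). Then ∫_K v̂² dx dy + ∫_{∂K} v² dμ + ∫_{∂K} (∂_n v)² dμ ≤ C ∫_K |D²v|² dx dy, where |D²v|² is the sum of the squares of all four second-order partial derivatives of v, the boundary integrals are taken with respect to the one-dimensional Hausdorff (arclength) measure μ on ∂K, and on each of the four edges of K the normal derivative ∂_n v is the derivative of v in the direction of the constant outward unit normal of that edge. -/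

import Mathlib

open MeasureTheory

/-- The space of bivariate real polynomials of total degree at most `k`, for an
integer `k` (so that `k < 0` gives the zero space, e.g. `P₋₁ = {0}`). -/
def polyLE (k : ℤ) : Set (MvPolynomial (Fin 2) ℝ) :=
  {m | m = 0 ∨ (0 ≤ k ∧ (m.totalDegree : ℤ) ≤ k)}

/-- Evaluation of a bivariate polynomial at a point of `ℝ × ℝ`. -/
noncomputable def evP (q : MvPolynomial (Fin 2) ℝ) (z : ℝ × ℝ) : ℝ :=
  MvPolynomial.eval ![z.1, z.2] q

/-- First partial derivative (in the first variable) of a function on `ℝ × ℝ`. -/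
noncomputable def pd1 (v : ℝ × ℝ → ℝ) (z : ℝ × ℝ) : ℝ :=
  deriv (fun x => v (x, z.2)) z.1

/-- First partial derivative (in the second variable) of a function on `ℝ × ℝ`. -/
noncomputable def pd2 (v : ℝ × ℝ → ℝ) (z : ℝ × ℝ) : ℝ :=
  deriv (fun y => v (z.1, y)) z.2

/-- Sum of the squares of the four second-order partial derivatives of a
function of two real variables, i.e. `|D²v|²`. -/
noncomputable def hessSq2 (v : ℝ × ℝ → ℝ) (z : ℝ × ℝ) : ℝ :=
  (pd1 (pd1 v) z) ^ 2 + (pd2 (pd1 v) z) ^ 2 + (pd1 (pd2 v) z) ^ 2 + (pd2 (pd2 v) z) ^ 2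

/-- The outward normal derivative of a function on the boundary of the unit
square: on each edge it is the derivative in the direction of the constant
outward unit normal of that edge. -/
noncomputable def normalDeriv2 (v : ℝ × ℝ → ℝ) (z : ℝ × ℝ) : ℝ :=
  if z.2 = 0 then -(pd2 v z)
  else if z.2 = 1 then pd2 v z
  else if z.1 = 0 then -(pd1 v z)
  else if z.1 = 1 then pd1 v z
  else 0

/-- The restriction of Lebesgue measure to `[0,1]`. -/
noncomputable def muI : Measure ℝ := volume.restrict (Set.Icc (0 : ℝ) 1)

instance muI_prob : IsProbabilityMeasure muI := ⟨by simp [muI]⟩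

lemma muI_prod : muI.prod muI =
    volume.restrict (Set.Icc (0 : ℝ) 1 ×ˢ Set.Icc (0 : ℝ) 1) := by
  unfold muI
  rw [Measure.prod_restrict]
  rfl

lemma restrict_K :
    (volume.restrict (Set.Ioo (0 : ℝ) 1 ×ˢ Set.Ioo (0 : ℝ) 1) : Measure (ℝ × ℝ)) =
      muI.prod muI := by
  unfold muI
  rw [Measure.volume_eq_prod, ← Measure.prod_restrict, restrict_Ioo_eq_restrict_Icc]

lemma intQ {g : ℝ × ℝ → ℝ}
    (hg : ContinuousOn g (Set.Icc (0 : ℝ) 1 ×ˢ Set.Icc (0 : ℝ) 1)) :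
    Integrable g (muI.prod muI) := by
  rw [muI_prod]
  exact hg.integrableOn_compact (isCompact_Icc.prod isCompact_Icc)

lemma intQ2 {g : ℝ × ℝ → ℝ}
    (hg : ContinuousOn g (Set.Icc (0 : ℝ) 1 ×ˢ Set.Icc (0 : ℝ) 1)) :
    Integrable (fun z => (g z) ^ 2) (muI.prod muI) := intQ (hg.pow 2)

lemma integral_add_mul {μ : Measure (ℝ × ℝ)} {f g : ℝ × ℝ → ℝ} (hf : Integrable f μ)
    (hg : Integrable g μ) (c : ℝ) :
    ∫ z, (f z + c * g z) ∂μ = (∫ z, f z ∂μ) + c * ∫ z, g z ∂μ := by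
  rw [integral_add hf (hg.const_mul _), integral_const_mul]

lemma int1 {g : ℝ → ℝ} (hg : ContinuousOn g (Set.Icc (0 : ℝ) 1)) : Integrable g muI :=
  hg.integrableOn_compact isCompact_Icc

lemma sliceR {g : ℝ × ℝ → ℝ}
    (hg : ContinuousOn g (Set.Icc (0 : ℝ) 1 ×ˢ Set.Icc (0 : ℝ) 1)) {x : ℝ}
    (hx : x ∈ Set.Icc (0 : ℝ) 1) : ContinuousOn (fun y => g (x, y)) (Set.Icc (0 : ℝ) 1) :=
  hg.comp (by fun_prop) (fun _ hy => ⟨hx, hy⟩)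

lemma sliceL {g : ℝ × ℝ → ℝ}
    (hg : ContinuousOn g (Set.Icc (0 : ℝ) 1 ×ˢ Set.Icc (0 : ℝ) 1)) {y : ℝ}
    (hy : y ∈ Set.Icc (0 : ℝ) 1) : ContinuousOn (fun x => g (x, y)) (Set.Icc (0 : ℝ) 1) :=
  hg.comp (by fun_prop) (fun _ hx => ⟨hx, hy⟩)

lemma ae_muI : ∀ᵐ x ∂muI, x ∈ Set.Icc (0 : ℝ) 1 := ae_restrict_mem measurableSet_Icc

lemma ae_Q : ∀ᵐ z ∂(muI.prod muI), z ∈ Set.Icc (0 : ℝ) 1 ×ˢ Set.Icc (0 : ℝ) 1 := by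
  rw [muI_prod]
  exact ae_restrict_mem (measurableSet_Icc.prod measurableSet_Icc)

lemma one_dim_le {g g' : ℝ → ℝ} (hg' : ContinuousOn g' (Set.Icc (0 : ℝ) 1))
    (hd : ∀ t ∈ Set.Icc (0 : ℝ) 1, HasDerivAt g (g' t) t) {s t : ℝ}
    (hs : s ∈ Set.Icc (0 : ℝ) 1) (ht : t ∈ Set.Icc (0 : ℝ) 1) (hst : s ≤ t) :
    (g t - g s) ^ 2 ≤ ∫ r, (g' r) ^ 2 ∂muI := by
  have hsub : Set.Icc s t ⊆ Set.Icc (0 : ℝ) 1 := Set.Icc_subset_Icc hs.1 ht.2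
  have hu : Set.uIcc s t = Set.Icc s t := Set.uIcc_of_le hst
  have hc : ContinuousOn g' (Set.uIcc s t) := by rw [hu]; exact hg'.mono hsub
  have hi : IntervalIntegrable g' volume s t := hc.intervalIntegrable
  have hi2 : IntervalIntegrable (fun r => (g' r) ^ 2) volume s t :=
    (hc.pow 2).intervalIntegrable
  have hF : ∫ r in s..t, g' r = g t - g s :=
    intervalIntegral.integral_eq_sub_of_hasDerivAt
      (fun r hr => hd r (hsub (hu ▸ hr))) hi
  set I := g t - g s with hI
  have h0 : 0 ≤ ∫ r in s..t, (g' r - I) ^ 2 :=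
    intervalIntegral.integral_nonneg hst (fun r _ => sq_nonneg _)
  have h1 : ∫ r in s..t, (g' r - I) ^ 2 =
      (∫ r in s..t, (g' r) ^ 2) - 2 * I * I + (t - s) * I ^ 2 := by
    have : ∀ r, (g' r - I) ^ 2 = (g' r) ^ 2 - 2 * I * g' r + I ^ 2 := fun r => by ring
    simp_rw [this]
    rw [intervalIntegral.integral_add (hi2.sub (hi.const_mul _)) (by simp),
      intervalIntegral.integral_sub hi2 (hi.const_mul _),
      intervalIntegral.integral_const_mul, hF]
    simp
  have h2 : ∫ r in s..t, (g' r) ^ 2 ≤ ∫ r, (g' r) ^ 2 ∂muI := by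
    rw [intervalIntegral.integral_of_le hst, muI]
    apply setIntegral_mono_set
    · exact int1 (hg'.pow 2)
    · exact Filter.Eventually.of_forall (fun r => sq_nonneg _)
    · exact (Set.Ioc_subset_Icc_self.trans hsub).eventuallyLE
  have h3 : (t - s) * I ^ 2 ≤ 1 * I ^ 2 := by
    apply mul_le_mul_of_nonneg_right _ (sq_nonneg _)
    linarith [hs.1, ht.2]
  nlinarith

lemma one_dim {g g' : ℝ → ℝ} (hg' : ContinuousOn g' (Set.Icc (0 : ℝ) 1))
    (hd : ∀ t ∈ Set.Icc (0 : ℝ) 1, HasDerivAt g (g' t) t) {s t : ℝ}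
    (hs : s ∈ Set.Icc (0 : ℝ) 1) (ht : t ∈ Set.Icc (0 : ℝ) 1) :
    (g t - g s) ^ 2 ≤ ∫ r, (g' r) ^ 2 ∂muI := by
  rcases le_total s t with h | h
  · exact one_dim_le hg' hd hs ht h
  · have := one_dim_le hg' hd ht hs h
    nlinarith

/-- `f` has continuous partial derivatives `fx`, `fy` on the closed unit square. -/
structure C1Q (f fx fy : ℝ × ℝ → ℝ) : Prop where
  c : ContinuousOn f (Set.Icc (0 : ℝ) 1 ×ˢ Set.Icc (0 : ℝ) 1)
  cx : ContinuousOn fx (Set.Icc (0 : ℝ) 1 ×ˢ Set.Icc (0 : ℝ) 1)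
  cy : ContinuousOn fy (Set.Icc (0 : ℝ) 1 ×ˢ Set.Icc (0 : ℝ) 1)
  dx : ∀ x ∈ Set.Icc (0 : ℝ) 1, ∀ y ∈ Set.Icc (0 : ℝ) 1,
    HasDerivAt (fun s => f (s, y)) (fx (x, y)) x
  dy : ∀ x ∈ Set.Icc (0 : ℝ) 1, ∀ y ∈ Set.Icc (0 : ℝ) 1,
    HasDerivAt (fun s => f (x, s)) (fy (x, y)) y

lemma C1Q.swap {f fx fy : ℝ × ℝ → ℝ} (h : C1Q f fx fy) :
    C1Q (fun z => f (z.2, z.1)) (fun z => fy (z.2, z.1)) (fun z => fx (z.2, z.1)) where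
  c := h.c.comp (by fun_prop) (fun z hz => ⟨hz.2, hz.1⟩)
  cx := h.cy.comp (by fun_prop) (fun z hz => ⟨hz.2, hz.1⟩)
  cy := h.cx.comp (by fun_prop) (fun z hz => ⟨hz.2, hz.1⟩)
  dx := fun x hx y hy => h.dy y hy x hx
  dy := fun x hx y hy => h.dx y hy x hx

lemma C1Q.vert {f fx fy : ℝ × ℝ → ℝ} (h : C1Q f fx fy)
    (h0 : ∫ z, f z ∂(muI.prod muI) = 0) {x : ℝ} (hx : x ∈ Set.Icc (0 : ℝ) 1) :
    ∫ y, (f (x, y)) ^ 2 ∂muI ≤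
      2 * (∫ z, (fx z) ^ 2 ∂(muI.prod muI)) + 2 * ∫ z, (fy z) ^ 2 ∂(muI.prod muI) := by
  have ix2 := intQ2 h.cx
  have iy2 := intQ2 h.cy
  have i1 := intQ h.c
  have i2 := intQ2 h.c
  have key : ∀ y ∈ Set.Icc (0 : ℝ) 1, (f (x, y)) ^ 2 ≤
      2 * (∫ t, (fx (t, y)) ^ 2 ∂muI) + 2 * ∫ z, (fy z) ^ 2 ∂(muI.prod muI) := by
    intro y hy
    set a := f (x, y) with ha
    set A := ∫ t, (fx (t, y)) ^ 2 ∂muI with hA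
    have iB : Integrable (fun z : ℝ × ℝ => ∫ t, (fy (z.1, t)) ^ 2 ∂muI) (muI.prod muI) :=
      (iy2.integral_prod_left).comp_fst _
    have hpt : ∀ z ∈ Set.Icc (0 : ℝ) 1 ×ˢ Set.Icc (0 : ℝ) 1,
        (a - f z) ^ 2 ≤ 2 * A + 2 * ∫ t, (fy (z.1, t)) ^ 2 ∂muI := by
      rintro ⟨x', y'⟩ ⟨hx', hy'⟩
      simp only at hx' hy' ⊢
      have e1 : (f (x, y) - f (x', y)) ^ 2 ≤ A :=
        one_dim (g := fun s => f (s, y)) (g' := fun s => fx (s, y)) (sliceL h.cx hy)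
          (fun t ht => h.dx t ht y hy) hx' hx
      have e2 : (f (x', y) - f (x', y')) ^ 2 ≤ ∫ t, (fy (x', t)) ^ 2 ∂muI :=
        one_dim (g := fun s => f (x', s)) (g' := fun s => fy (x', s)) (sliceR h.cy hx')
          (fun t ht => h.dy x' hx' t ht) hy' hy
      nlinarith [sq_nonneg ((f (x, y) - f (x', y)) - (f (x', y) - f (x', y')))]
    have iL : Integrable (fun z => a ^ 2 - 2 * a * f z + (f z) ^ 2) (muI.prod muI) :=
      ((integrable_const _).sub (i1.const_mul _)).add i2
    have hint : ∫ z, (a ^ 2 - 2 * a * f z + (f z) ^ 2) ∂(muI.prod muI) ≤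
        ∫ z, (2 * A + 2 * ∫ t, (fy (z.1, t)) ^ 2 ∂muI) ∂(muI.prod muI) := by
      apply integral_mono_ae iL ((integrable_const _).add (iB.const_mul _))
      filter_upwards [ae_Q] with z hz
      have := hpt z hz
      change a ^ 2 - 2 * a * f z + (f z) ^ 2 ≤ 2 * A + 2 * ∫ t, (fy (z.1, t)) ^ 2 ∂muI
      nlinarith
    have iS : Integrable (fun z => a ^ 2 - 2 * a * f z) (muI.prod muI) :=
      (integrable_const _).sub (i1.const_mul _)
    rw [integral_add iS i2,
      integral_sub (integrable_const _) (i1.const_mul _), integral_const_mul, h0,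
      integral_add_mul (integrable_const _) iB] at hint
    have hB : ∫ z : ℝ × ℝ, (∫ t, (fy (z.1, t)) ^ 2 ∂muI) ∂(muI.prod muI) =
        ∫ z, (fy z) ^ 2 ∂(muI.prod muI) := by
      rw [integral_prod _ iB, integral_prod _ iy2]
      simp
    rw [hB] at hint
    simp at hint
    have hn : 0 ≤ ∫ z, (f z) ^ 2 ∂(muI.prod muI) := integral_nonneg (fun _ => sq_nonneg _)
    linarith
  have iA : Integrable (fun y : ℝ => ∫ t, (fx (t, y)) ^ 2 ∂muI) muI := ix2.integral_prod_right
  have : ∫ y, (f (x, y)) ^ 2 ∂muI ≤ ∫ y, (2 * (∫ t, (fx (t, y)) ^ 2 ∂muI) +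
      2 * ∫ z, (fy z) ^ 2 ∂(muI.prod muI)) ∂muI := by
    apply integral_mono_ae (int1 ((sliceR h.c hx).pow 2))
      ((iA.const_mul _).add (integrable_const _))
    filter_upwards [ae_muI] with y hy using key y hy
  rw [integral_add (iA.const_mul _) (integrable_const _), integral_const_mul,
    ← integral_prod_symm _ ix2] at this
  simpa using this

lemma int_swap (g : ℝ × ℝ → ℝ) :
    ∫ z : ℝ × ℝ, g (z.2, z.1) ∂(muI.prod muI) = ∫ z, g z ∂(muI.prod muI) :=
  integral_prod_swap (μ := muI) (ν := muI) g

lemma C1Q.horiz {f fx fy : ℝ × ℝ → ℝ} (h : C1Q f fx fy)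
    (h0 : ∫ z, f z ∂(muI.prod muI) = 0) {y : ℝ} (hy : y ∈ Set.Icc (0 : ℝ) 1) :
    ∫ x, (f (x, y)) ^ 2 ∂muI ≤
      2 * (∫ z, (fx z) ^ 2 ∂(muI.prod muI)) + 2 * ∫ z, (fy z) ^ 2 ∂(muI.prod muI) := by
  have := h.swap.vert (by rw [int_swap]; exact h0) hy
  rw [int_swap (fun z => (fx z) ^ 2), int_swap (fun z => (fy z) ^ 2)] at this
  simp only at this
  linarith

lemma C1Q.poincare {f fx fy : ℝ × ℝ → ℝ} (h : C1Q f fx fy)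
    (h0 : ∫ z, f z ∂(muI.prod muI) = 0) :
    ∫ z, (f z) ^ 2 ∂(muI.prod muI) ≤
      2 * (∫ z, (fx z) ^ 2 ∂(muI.prod muI)) + 2 * ∫ z, (fy z) ^ 2 ∂(muI.prod muI) := by
  have i2 := intQ2 h.c
  rw [integral_prod _ i2]
  refine (integral_mono_ae i2.integral_prod_left (integrable_const _) ?_).trans
    (le_of_eq (by simp only [integral_const, probReal_univ, one_smul]; rfl))
  filter_upwards [ae_muI] with x hx using h.vert h0 hx

lemma frontier_K : frontier (Set.Ioo (0 : ℝ) 1 ×ˢ Set.Ioo (0 : ℝ) 1) ⊆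
    (((fun x : ℝ => (x, (0 : ℝ))) '' Set.Icc 0 1 ∪ (fun x : ℝ => (x, (1 : ℝ))) '' Set.Icc 0 1) ∪
    ((fun x : ℝ => ((0 : ℝ), x)) '' Set.Icc 0 1)) ∪ (fun x : ℝ => ((1 : ℝ), x)) '' Set.Icc 0 1
      := by
  rw [frontier_prod_eq, closure_Ioo (by norm_num), frontier_Ioo (by norm_num)]
  rintro ⟨x, y⟩ (⟨h1, h2⟩ | ⟨h1, h2⟩)
  · rcases h2 with h2 | h2
    · exact Or.inl (Or.inl (Or.inl ⟨x, h1, by rw [← h2]⟩))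
    · exact Or.inl (Or.inl (Or.inr ⟨x, h1, by rw [← h2]⟩))
  · rcases h1 with h2' | h2'
    · exact Or.inl (Or.inr ⟨y, h2, by rw [← h2']⟩)
    · exact Or.inr ⟨y, h2, by rw [← h2']⟩

lemma edge_map {e : ℝ → ℝ × ℝ} (he : Isometry e) :
    (μH[1] : Measure (ℝ × ℝ)).restrict (e '' Set.Icc 0 1) = muI.map e := by
  have hm : MeasurableEmbedding e := he.isClosedEmbedding.measurableEmbedding
  have h1 := he.map_hausdorffMeasure (d := 1) (Or.inl zero_le_one)
  rw [hausdorffMeasure_real] at h1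
  rw [muI, ← Set.preimage_image_eq (Set.Icc (0 : ℝ) 1) he.injective, ← hm.restrict_map, h1,
    Measure.restrict_restrict (hm.measurableSet_image' measurableSet_Icc),
    Set.preimage_image_eq (Set.Icc (0 : ℝ) 1) he.injective,
    Set.inter_eq_left.2 (Set.image_subset_range _ _)]

lemma frontier_int {g : ℝ × ℝ → ℝ} (hg0 : ∀ z, 0 ≤ g z)
    (hg : ContinuousOn g (Set.Icc (0 : ℝ) 1 ×ˢ Set.Icc (0 : ℝ) 1)) :
    Integrable g ((μH[1] : Measure (ℝ × ℝ)).restrict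
      (frontier (Set.Ioo (0 : ℝ) 1 ×ˢ Set.Ioo (0 : ℝ) 1))) ∧
    ∫ z in frontier (Set.Ioo (0 : ℝ) 1 ×ˢ Set.Ioo (0 : ℝ) 1), g z ∂(μH[1]) ≤
      (∫ x, g (x, 0) ∂muI) + (∫ x, g (x, 1) ∂muI) + (∫ y, g (0, y) ∂muI) +
        ∫ y, g (1, y) ∂muI := by
  have E : ∀ e : ℝ → ℝ × ℝ, Isometry e → ContinuousOn (fun x => g (e x)) (Set.Icc 0 1) →
      Integrable g (muI.map e) ∧ ∫ z, g z ∂(muI.map e) = ∫ x, g (e x) ∂muI := by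
    intro e he hc
    have hm : MeasurableEmbedding e := he.isClosedEmbedding.measurableEmbedding
    exact ⟨hm.integrable_map_iff.2 (int1 hc), hm.integral_map _⟩
  have m0 : (0 : ℝ) ∈ Set.Icc (0 : ℝ) 1 := by simp
  have m1 : (1 : ℝ) ∈ Set.Icc (0 : ℝ) 1 := by simp
  have isoL : ∀ c : ℝ, Isometry (fun x : ℝ => (x, c)) := fun c =>
    Isometry.of_dist_eq (fun x y => by simp [Prod.dist_eq])
  have isoR : ∀ c : ℝ, Isometry (fun x : ℝ => (c, x)) := fun c =>
    Isometry.of_dist_eq (fun x y => by simp [Prod.dist_eq])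
  obtain ⟨a1, b1⟩ := E _ (isoL 0) (sliceL hg m0)
  obtain ⟨a2, b2⟩ := E _ (isoL 1) (sliceL hg m1)
  obtain ⟨a3, b3⟩ := E _ (isoR 0) (sliceR hg m0)
  obtain ⟨a4, b4⟩ := E _ (isoR 1) (sliceR hg m1)
  have hle : (μH[1] : Measure (ℝ × ℝ)).restrict
      (frontier (Set.Ioo (0 : ℝ) 1 ×ˢ Set.Ioo (0 : ℝ) 1)) ≤
      muI.map (fun x : ℝ => (x, (0 : ℝ))) + muI.map (fun x : ℝ => (x, (1 : ℝ))) +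
      muI.map (fun x : ℝ => ((0 : ℝ), x)) + muI.map (fun x : ℝ => ((1 : ℝ), x)) := by
    rw [← edge_map (isoL 0), ← edge_map (isoL 1), ← edge_map (isoR 0), ← edge_map (isoR 1)]
    refine (Measure.restrict_mono frontier_K le_rfl).trans ?_
    refine (Measure.restrict_union_le _ _).trans (add_le_add ?_ le_rfl)
    refine (Measure.restrict_union_le _ _).trans (add_le_add ?_ le_rfl)
    exact Measure.restrict_union_le _ _
  have I12 := a1.add_measure a2
  have I123 := I12.add_measure a3
  have I := I123.add_measure a4
  refine ⟨I.mono_measure hle, ?_⟩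
  refine (integral_mono_measure hle (Filter.Eventually.of_forall hg0) I).trans ?_
  rw [integral_add_measure I123 a4, integral_add_measure I12 a3, integral_add_measure a1 a2,
    b1, b2, b3, b4]

lemma C1Q.trace {f fx fy : ℝ × ℝ → ℝ} (h : C1Q f fx fy)
    (h0 : ∫ z, f z ∂(muI.prod muI) = 0) :
    Integrable (fun z => (f z) ^ 2) ((μH[1] : Measure (ℝ × ℝ)).restrict
      (frontier (Set.Ioo (0 : ℝ) 1 ×ˢ Set.Ioo (0 : ℝ) 1))) ∧
    ∫ z in frontier (Set.Ioo (0 : ℝ) 1 ×ˢ Set.Ioo (0 : ℝ) 1), (f z) ^ 2 ∂(μH[1]) ≤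
      8 * (∫ z, (fx z) ^ 2 ∂(muI.prod muI)) + 8 * ∫ z, (fy z) ^ 2 ∂(muI.prod muI) := by
  have m0 : (0 : ℝ) ∈ Set.Icc (0 : ℝ) 1 := by simp
  have m1 : (1 : ℝ) ∈ Set.Icc (0 : ℝ) 1 := by simp
  obtain ⟨a, b⟩ := frontier_int (fun z => sq_nonneg (f z)) (h.c.pow 2)
  refine ⟨a, b.trans ?_⟩
  linarith [h.vert h0 m0, h.vert h0 m1, h.horiz h0 m0, h.horiz h0 m1]

lemma pd1_eq {f : ℝ × ℝ → ℝ} {z : ℝ × ℝ} (h : DifferentiableAt ℝ f z) :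
    HasDerivAt (fun s => f (s, z.2)) (fderiv ℝ f z (1, 0)) z.1 := by
  have h1 : HasDerivAt (fun s : ℝ => (s, z.2)) ((1 : ℝ), (0 : ℝ)) z.1 :=
    (hasDerivAt_id z.1).prodMk (hasDerivAt_const _ _)
  exact HasFDerivAt.comp_hasDerivAt (f := fun s : ℝ => (s, z.2)) z.1 h.hasFDerivAt h1

lemma pd2_eq {f : ℝ × ℝ → ℝ} {z : ℝ × ℝ} (h : DifferentiableAt ℝ f z) :
    HasDerivAt (fun s => f (z.1, s)) (fderiv ℝ f z (0, 1)) z.2 := by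
  have h1 : HasDerivAt (fun s : ℝ => (z.1, s)) ((0 : ℝ), (1 : ℝ)) z.2 :=
    (hasDerivAt_const _ _).prodMk (hasDerivAt_id z.2)
  exact HasFDerivAt.comp_hasDerivAt (f := fun s : ℝ => (z.1, s)) z.2 h.hasFDerivAt h1

lemma pd_contDiff {f : ℝ × ℝ → ℝ} {U : Set (ℝ × ℝ)} (hU : IsOpen U) {n m : WithTop ℕ∞}
    (hmn : m + 1 ≤ n) (h : ContDiffOn ℝ n f U) :
    ContDiffOn ℝ m (pd1 f) U ∧ ContDiffOn ℝ m (pd2 f) U := by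
  have hF : ContDiffOn ℝ m (fderiv ℝ f) U := h.fderiv_of_isOpen hU hmn
  have hd : ∀ z ∈ U, DifferentiableAt ℝ f z := fun z hz =>
    (h.contDiffAt (hU.mem_nhds hz)).differentiableAt (by
      rintro rfl
      simp at hmn)
  exact ⟨(hF.clm_apply contDiffOn_const).congr (fun z hz => (pd1_eq (hd z hz)).deriv),
    (hF.clm_apply contDiffOn_const).congr (fun z hz => (pd2_eq (hd z hz)).deriv)⟩

lemma C1Q_of {f : ℝ × ℝ → ℝ} {U : Set (ℝ × ℝ)} (hU : IsOpen U)
    (hQ : Set.Icc (0 : ℝ) 1 ×ˢ Set.Icc (0 : ℝ) 1 ⊆ U) (h : ContDiffOn ℝ 1 f U) :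
    C1Q f (pd1 f) (pd2 f) := by
  have hd : ∀ z ∈ U, DifferentiableAt ℝ f z := fun z hz =>
    (h.contDiffAt (hU.mem_nhds hz)).differentiableAt (by simp)
  obtain ⟨h1, h2⟩ := pd_contDiff (m := 0) hU (by simp) h
  refine ⟨h.continuousOn.mono hQ, h1.continuousOn.mono hQ, h2.continuousOn.mono hQ, ?_, ?_⟩
  · intro x hx y hy
    exact (pd1_eq (hd (x, y) (hQ ⟨hx, hy⟩))).differentiableAt.hasDerivAt
  · intro x hx y hy
    exact (pd2_eq (hd (x, y) (hQ ⟨hx, hy⟩))).differentiableAt.hasDerivAt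

lemma normal_le (v : ℝ × ℝ → ℝ) (z : ℝ × ℝ) :
    (normalDeriv2 v z) ^ 2 ≤ (pd1 v z) ^ 2 + (pd2 v z) ^ 2 := by
  unfold normalDeriv2
  split_ifs <;> nlinarith [sq_nonneg (pd1 v z), sq_nonneg (pd2 v z)]

lemma evP_cont (q : MvPolynomial (Fin 2) ℝ) : Continuous (evP q) := by
  unfold evP
  have h1 := MvPolynomial.continuous_eval q
  refine h1.comp (continuous_pi fun i => ?_)
  fin_cases i
  · exact continuous_fst
  · exact continuous_snd

lemma proj_le {v w : ℝ × ℝ → ℝ}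
    (hv : ContinuousOn v (Set.Icc (0 : ℝ) 1 ×ˢ Set.Icc (0 : ℝ) 1)) (hw : Continuous w)
    (h : ∫ z, (v z - w z) * w z ∂(muI.prod muI) = 0) :
    ∫ z, (w z) ^ 2 ∂(muI.prod muI) ≤ ∫ z, (v z) ^ 2 ∂(muI.prod muI) := by
  have i1 := intQ2 hw.continuousOn
  have i2 : Integrable (fun z => (v z - w z) * w z) (muI.prod muI) :=
    intQ ((hv.sub hw.continuousOn).mul hw.continuousOn)
  have i3 := intQ2 hv
  have : ∫ z, ((w z) ^ 2 + 2 * ((v z - w z) * w z)) ∂(muI.prod muI) ≤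
      ∫ z, (v z) ^ 2 ∂(muI.prod muI) := by
    apply integral_mono (i1.add (i2.const_mul _)) i3
    intro z
    change (w z) ^ 2 + 2 * ((v z - w z) * w z) ≤ (v z) ^ 2
    nlinarith [sq_nonneg (v z - w z)]
  rw [integral_add_mul i1 i2, h] at this
  simpa using this

/-- upper stability bound for the `C¹` (biharmonic) virtual
element stabilization on the unit square, for `C²` functions with zero average
and zero gradient average over the square:
`‖Π⁰_{p−4} v‖²_{0,K} + ‖v‖²_{0,∂K} + ‖∂ₙv‖²_{0,∂K} ≤ C |v|²_{2,K}`.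
The boundary integrals are with respect to the 1-dimensional Hausdorff measure. -/
theorem stmt_11 (p : ℕ) (hp : 3 ≤ p) :
    ∃ C : ℝ, 0 < C ∧ ∀ v : ℝ × ℝ → ℝ,
      (∃ U : Set (ℝ × ℝ), IsOpen U ∧ Set.Icc ((0 : ℝ), (0 : ℝ)) (1, 1) ⊆ U ∧
        ContDiffOn ℝ 2 v U) →
      (∫ z in Set.Ioo (0 : ℝ) 1 ×ˢ Set.Ioo (0 : ℝ) 1, v z) = 0 →
      (∫ z in Set.Ioo (0 : ℝ) 1 ×ˢ Set.Ioo (0 : ℝ) 1, pd1 v z) = 0 →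
      (∫ z in Set.Ioo (0 : ℝ) 1 ×ˢ Set.Ioo (0 : ℝ) 1, pd2 v z) = 0 →
      ∀ vhat : MvPolynomial (Fin 2) ℝ,
        vhat ∈ polyLE ((p : ℤ) - 4) →
        (∀ m ∈ polyLE ((p : ℤ) - 4),
          (∫ z in Set.Ioo (0 : ℝ) 1 ×ˢ Set.Ioo (0 : ℝ) 1,
            (v z - evP vhat z) * evP m z) = 0) →
        (∫ z in Set.Ioo (0 : ℝ) 1 ×ˢ Set.Ioo (0 : ℝ) 1, (evP vhat z) ^ 2) +
          (∫ z in frontier (Set.Ioo (0 : ℝ) 1 ×ˢ Set.Ioo (0 : ℝ) 1),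
            (v z) ^ 2 ∂(μH[1])) +
          (∫ z in frontier (Set.Ioo (0 : ℝ) 1 ×ˢ Set.Ioo (0 : ℝ) 1),
            (normalDeriv2 v z) ^ 2 ∂(μH[1])) ≤
        C * ∫ z in Set.Ioo (0 : ℝ) 1 ×ˢ Set.Ioo (0 : ℝ) 1, hessSq2 v z := by
  refine ⟨100, by norm_num, ?_⟩
  rintro v ⟨U, hU, hQU, hv⟩ h0 h1 h2 vhat hvh hproj
  have hQ : Set.Icc (0 : ℝ) 1 ×ˢ Set.Icc (0 : ℝ) 1 ⊆ U := by
    rw [Set.Icc_prod_Icc]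
    exact hQU
  have hp := hproj vhat hvh
  rw [restrict_K] at h0 h1 h2 hp ⊢
  obtain ⟨hv1, hv2⟩ := pd_contDiff (m := 1) hU (by norm_num) hv
  have c0 := C1Q_of hU hQ (hv.of_le (by norm_num))
  have c1 := C1Q_of hU hQ hv1
  have c2 := C1Q_of hU hQ hv2
  have hw := proj_le c0.c (evP_cont vhat) hp
  have q0 := c0.poincare h0
  have q1 := c1.poincare h1
  have q2 := c2.poincare h2
  have t0 := (c0.trace h0).2
  obtain ⟨i1, t1⟩ := c1.trace h1
  obtain ⟨i2, t2⟩ := c2.trace h2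
  have hn : ∫ z in frontier (Set.Ioo (0 : ℝ) 1 ×ˢ Set.Ioo (0 : ℝ) 1),
      (normalDeriv2 v z) ^ 2 ∂(μH[1]) ≤
      (∫ z in frontier (Set.Ioo (0 : ℝ) 1 ×ˢ Set.Ioo (0 : ℝ) 1), (pd1 v z) ^ 2 ∂(μH[1])) +
      ∫ z in frontier (Set.Ioo (0 : ℝ) 1 ×ˢ Set.Ioo (0 : ℝ) 1), (pd2 v z) ^ 2 ∂(μH[1]) := by
    rw [← integral_add i1 i2]
    exact integral_mono_of_nonneg (Filter.Eventually.of_forall fun z => sq_nonneg _)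
      (i1.add i2) (Filter.Eventually.of_forall fun z => normal_le v z)
  have hH : ∫ z, hessSq2 v z ∂(muI.prod muI) =
      (∫ z, (pd1 (pd1 v) z) ^ 2 ∂(muI.prod muI)) + (∫ z, (pd2 (pd1 v) z) ^ 2 ∂(muI.prod muI)) +
      (∫ z, (pd1 (pd2 v) z) ^ 2 ∂(muI.prod muI)) + ∫ z, (pd2 (pd2 v) z) ^ 2 ∂(muI.prod muI) := by
    have j1 := intQ2 c1.cx
    have j2 := intQ2 c1.cy
    have j3 := intQ2 c2.cx
    have j4 := intQ2 c2.cy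
    have j12 : Integrable (fun z => (pd1 (pd1 v) z) ^ 2 + (pd2 (pd1 v) z) ^ 2)
      (muI.prod muI) := j1.add j2
    have j123 : Integrable (fun z => (pd1 (pd1 v) z) ^ 2 + (pd2 (pd1 v) z) ^ 2 +
      (pd1 (pd2 v) z) ^ 2) (muI.prod muI) := j12.add j3
    unfold hessSq2
    rw [integral_add j123 j4, integral_add j12 j3, integral_add j1 j2]
  have n1 : 0 ≤ ∫ z, (pd1 (pd1 v) z) ^ 2 ∂(muI.prod muI) := integral_nonneg fun _ => sq_nonneg _
  have n2 : 0 ≤ ∫ z, (pd2 (pd1 v) z) ^ 2 ∂(muI.prod muI) := integral_nonneg fun _ => sq_nonneg _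
  have n3 : 0 ≤ ∫ z, (pd1 (pd2 v) z) ^ 2 ∂(muI.prod muI) := integral_nonneg fun _ => sq_nonneg _
  have n4 : 0 ≤ ∫ z, (pd2 (pd2 v) z) ^ 2 ∂(muI.prod muI) := integral_nonneg fun _ => sq_nonneg _
  rw [hH]
  linarith
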